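/- arXiv:2308.08026 — 2 statements merged into one kernel-verified Lean document; each statement's English description precedes it below -/
import Mathlib

section
/- The B-linear map d_q is injective on B⊗̂R, i.e., its restriction d_q : B⊗̂R → B⊗̂V is injective, so d_q maps B⊗̂R isomorphically onto its image d_q(B⊗̂R). -/
/-!
`B` is a "deformation base": a commutative Noetherian local ℂ-algebra, complete in the
`𝔪`-adic topology, with residue field `ℂ`.  For a ℂ-vector space `X`, the completed
tensor product `B ⊗̂ X` is the `𝔪`-adic completion of `B ⊗[ℂ] X`, realized as the
inverse limit of the modules `(B ⊗[ℂ] X) ⧸ 𝔪^k (B ⊗[ℂ] X) ≅ B/𝔪^k ⊗[ℂ] X`.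
-/

open scoped TensorProduct
open IsLocalRing

/-- The completed tensor product `B ⊗̂ X`. -/
noncomputable abbrev CTP (B : Type) [CommRing B] [Algebra ℂ B] [IsLocalRing B]
    (X : Type) [AddCommGroup X] [Module ℂ X] : Type :=
  AdicCompletion (maximalIdeal B) (B ⊗[ℂ] X)

/-- The canonical embedding `X → B ⊗̂ X`, `x ↦ 1 ⊗ x`. -/
noncomputable def iota (B : Type) [CommRing B] [Algebra ℂ B] [IsLocalRing B]
    (X : Type) [AddCommGroup X] [Module ℂ X] (x : X) : CTP B X :=
  AdicCompletion.of (maximalIdeal B) (B ⊗[ℂ] X) ((1 : B) ⊗ₜ x)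

/-- The submodule `𝔪^k X ⊆ B ⊗̂ X`: the kernel of the canonical projection
`B ⊗̂ X → (B ⊗[ℂ] X) ⧸ 𝔪^k (B ⊗[ℂ] X) ≅ B/𝔪^k ⊗[ℂ] X`. -/
noncomputable def mpow (B : Type) [CommRing B] [Algebra ℂ B] [IsLocalRing B]
    (X : Type) [AddCommGroup X] [Module ℂ X] (k : ℕ) : Submodule B (CTP B X) :=
  LinearMap.ker (AdicCompletion.eval (maximalIdeal B) (B ⊗[ℂ] X) k)

/-- The `𝔪`-adic topology on `B ⊗̂ X`, generated by the cosets `x + 𝔪^k X`. -/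
noncomputable def adicTop (B : Type) [CommRing B] [Algebra ℂ B] [IsLocalRing B]
    (X : Type) [AddCommGroup X] [Module ℂ X] : TopologicalSpace (CTP B X) :=
  TopologicalSpace.generateFrom
    {s | ∃ (x : CTP B X) (k : ℕ), s = {y | y - x ∈ mpow B X k}}

/-- For a ℂ-subspace `W ⊆ V`, the `B`-submodule `B ⊗̂ W ⊆ B ⊗̂ V`: those elements all of
whose finite-level components `(B ⊗[ℂ] V) ⧸ 𝔪^n (B ⊗[ℂ] V)` come from `B ⊗[ℂ] W`. -/
noncomputable def csub (B : Type) [CommRing B] [Algebra ℂ B] [IsLocalRing B]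
    (V : Type) [AddCommGroup V] [Module ℂ V] (W : Submodule ℂ V) :
    Submodule B (CTP B V) :=
  ⨅ n : ℕ, Submodule.comap
    (AdicCompletion.eval (maximalIdeal B) (B ⊗[ℂ] V) n)
    (LinearMap.range ((Submodule.mkQ ((maximalIdeal B) ^ n • ⊤)).comp
      ((W.subtype).baseChange B)))

/-- Since `𝔪` is finitely generated, `𝔪^k X` is the submodule `𝔪^k • (B ⊗̂ X)`. -/
lemma mpow_eq_smul_top (B : Type) [CommRing B] [Algebra ℂ B] [IsNoetherianRing B]
    [IsLocalRing B] (X : Type) [AddCommGroup X] [Module ℂ X] (k : ℕ) :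
    mpow B X k = (maximalIdeal B) ^ k • (⊤ : Submodule B (CTP B X)) :=
  (AdicCompletion.pow_smul_top_eq_ker_eval (IsNoetherian.noetherian _)).symm

lemma smul_mem_mpow_add {B : Type} [CommRing B] [Algebra ℂ B] [IsNoetherianRing B]
    [IsLocalRing B] {X : Type} [AddCommGroup X] [Module ℂ X] {k l : ℕ} {b : B}
    (hb : b ∈ (maximalIdeal B) ^ k) {x : CTP B X} (hx : x ∈ mpow B X l) :
    b • x ∈ mpow B X (k + l) := by
  rw [mpow_eq_smul_top] at hx ⊢
  rw [pow_add, ← smul_eq_mul, Submodule.smul_assoc]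
  exact Submodule.smul_mem_smul hb hx

/-- A `B`-linear map between completed tensor products is `𝔪`-adically continuous. -/
lemma map_mem_mpow {B : Type} [CommRing B] [Algebra ℂ B] [IsNoetherianRing B]
    [IsLocalRing B] {X Y : Type} [AddCommGroup X] [Module ℂ X] [AddCommGroup Y] [Module ℂ Y]
    (f : CTP B X →ₗ[B] CTP B Y) {k : ℕ} {x : CTP B X} (hx : x ∈ mpow B X k) :
    f x ∈ mpow B Y k := by
  rw [mpow_eq_smul_top] at hx ⊢
  exact Submodule.smul_top_le_comap_smul_top _ f hx

lemma of_mem_mpow_iff {B : Type} [CommRing B] [Algebra ℂ B] [IsLocalRing B]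
    {X : Type} [AddCommGroup X] [Module ℂ X] {k : ℕ} {t : B ⊗[ℂ] X} :
    AdicCompletion.of (maximalIdeal B) (B ⊗[ℂ] X) t ∈ mpow B X k ↔
      t ∈ (maximalIdeal B) ^ k • (⊤ : Submodule B (B ⊗[ℂ] X)) := by
  rw [mpow, LinearMap.mem_ker, AdicCompletion.eval_of, Submodule.mkQ_apply,
    Submodule.Quotient.mk_eq_zero]

/-- A `B`-linear map with leading term `d` agrees with `1 ⊗ d` modulo `𝔪`. -/
lemma sub_baseChange_mem_mpow_one {B : Type} [CommRing B] [Algebra ℂ B]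
    [IsLocalRing B] {X Y : Type} [AddCommGroup X] [Module ℂ X] [AddCommGroup Y] [Module ℂ Y]
    {d : X →ₗ[ℂ] Y} {f : CTP B X →ₗ[B] CTP B Y}
    (hlead : ∀ x : X, f (iota B X x) - iota B Y (d x) ∈ mpow B Y 1) (t : B ⊗[ℂ] X) :
    f (AdicCompletion.of _ _ t) - AdicCompletion.of _ _ (d.baseChange B t) ∈ mpow B Y 1 := by
  induction t with
  | zero => simp
  | add s t hs ht =>
    simp only [map_add, add_sub_add_comm]
    exact add_mem hs ht
  | tmul b x =>
    have hbx : b ⊗ₜ[ℂ] x = b • ((1 : B) ⊗ₜ[ℂ] x) := by simp [TensorProduct.smul_tmul']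
    rw [hbx, map_smul, map_smul, map_smul, map_smul, ← smul_sub]
    exact Submodule.smul_mem _ _ (hlead x)

/-- A `B`-linear map with leading term `d` agrees with `1 ⊗ d` on `𝔪^k (B ⊗ X)` modulo
`𝔪^(k+1)`. -/
lemma sub_baseChange_mem_mpow_succ {B : Type} [CommRing B] [Algebra ℂ B] [IsNoetherianRing B]
    [IsLocalRing B] {X Y : Type} [AddCommGroup X] [Module ℂ X] [AddCommGroup Y] [Module ℂ Y]
    {d : X →ₗ[ℂ] Y} {f : CTP B X →ₗ[B] CTP B Y}
    (hlead : ∀ x : X, f (iota B X x) - iota B Y (d x) ∈ mpow B Y 1) {k : ℕ} {t : B ⊗[ℂ] X}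
    (ht : t ∈ (maximalIdeal B) ^ k • (⊤ : Submodule B (B ⊗[ℂ] X))) :
    f (AdicCompletion.of _ _ t) - AdicCompletion.of _ _ (d.baseChange B t) ∈
      mpow B Y (k + 1) := by
  induction ht using Submodule.smul_induction_on' with
  | smul b hb s _ =>
    rw [map_smul, map_smul, map_smul, map_smul, ← smul_sub]
    exact smul_mem_mpow_add hb (sub_baseChange_mem_mpow_one hlead s)
  | add s _ t _ hs ht =>
    simp only [map_add, add_sub_add_comm]
    exact add_mem hs ht

/-- If the leading term of `f` is injective on `W`, then no nonzero element of `B ⊗̂ W` is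
killed by `f`. -/
lemma eq_zero_of_mem_csub {B : Type} [CommRing B] [Algebra ℂ B] [IsNoetherianRing B]
    [IsLocalRing B] {X Y : Type} [AddCommGroup X] [Module ℂ X] [AddCommGroup Y] [Module ℂ Y]
    {d : X →ₗ[ℂ] Y} {f : CTP B X →ₗ[B] CTP B Y}
    (hlead : ∀ x : X, f (iota B X x) - iota B Y (d x) ∈ mpow B Y 1)
    {W : Submodule ℂ X} (hW : Disjoint (LinearMap.ker d) W)
    {z : CTP B X} (hz : z ∈ csub B X W) (hfz : f z = 0) : z = 0 := by
  obtain ⟨g, hg⟩ := (d ∘ₗ W.subtype).exists_leftInverse_of_injective <| by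
    rw [LinearMap.ker_comp, ← Submodule.disjoint_iff_comap_eq_bot]
    exact hW.symm
  suffices h : ∀ k, z ∈ mpow B X k from AdicCompletion.ext fun k => h k
  intro k
  induction k with
  | zero => rw [mpow_eq_smul_top]; simp
  | succ k ih =>
    obtain ⟨u, hu⟩ := Submodule.mem_iInf _ |>.mp hz (k + 1)
    set w := W.subtype.baseChange B u with hw
    have hzw : z - AdicCompletion.of _ _ w ∈ mpow B X (k + 1) := by
      rw [mpow, LinearMap.mem_ker, map_sub, AdicCompletion.eval_of, sub_eq_zero]
      exact hu.symm
    have hle : mpow B X (k + 1) ≤ mpow B X k := by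
      rw [mpow_eq_smul_top, mpow_eq_smul_top]
      exact Submodule.smul_mono_left (Ideal.pow_le_pow_right k.le_succ)
    have hwk := of_mem_mpow_iff.mp (by simpa using sub_mem ih (hle hzw))
    have hfw : f (AdicCompletion.of _ _ w) ∈ mpow B Y (k + 1) := by
      simpa [hfz] using map_mem_mpow f hzw
    have hdw : d.baseChange B w ∈ (maximalIdeal B) ^ (k + 1) • (⊤ : Submodule B (B ⊗[ℂ] Y)) := by
      rw [← of_mem_mpow_iff]
      simpa using sub_mem hfw (sub_baseChange_mem_mpow_succ hlead hwk)
    have hgw : (W.subtype ∘ₗ g).baseChange B (d.baseChange B w) = w := by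
      have hgd : (W.subtype ∘ₗ g) ∘ₗ d ∘ₗ W.subtype = W.subtype := by
        rw [LinearMap.comp_assoc, hg, LinearMap.comp_id]
      rw [hw, ← LinearMap.comp_apply, ← LinearMap.comp_apply, ← LinearMap.baseChange_comp,
        ← LinearMap.baseChange_comp, LinearMap.comp_assoc, hgd]
    have hwk' : w ∈ (maximalIdeal B) ^ (k + 1) • (⊤ : Submodule B (B ⊗[ℂ] X)) := by
      rw [← hgw]
      exact Submodule.smul_top_le_comap_smul_top _ _ hdw
    simpa using add_mem hzw (of_mem_mpow_iff.mpr hwk')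

/-- The deformed differential `d_q` is injective on `B ⊗̂ R`, hence maps
`B ⊗̂ R` isomorphically onto its image `d_q(B ⊗̂ R)`. -/
theorem dq_injective_on_R
    (B : Type) [CommRing B] [Algebra ℂ B] [IsNoetherianRing B] [IsLocalRing B]
    [IsAdicComplete (maximalIdeal B) B]
    (hres : Function.Bijective (algebraMap ℂ (ResidueField B)))
    (V : Type) [AddCommGroup V] [Module ℂ V]
    (H I R : Submodule ℂ V) (d : V →ₗ[ℂ] V)
    (hsup : H ⊔ I ⊔ R = ⊤)
    (hdisjH : Disjoint H (I ⊔ R)) (hdisjIR : Disjoint I R)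
    (hI : I = LinearMap.range d)
    (hker : LinearMap.ker d = H ⊔ I)
    (dq : CTP B V →ₗ[B] CTP B V)
    (hlead : ∀ v : V, dq (iota B V v) - iota B V (d v) ∈ mpow B V 1) :
    Set.InjOn dq (csub B V R) := by
  intro x hx y hy hxy
  have hW : Disjoint (LinearMap.ker d) R :=
    hker ▸ hdisjIR.disjoint_sup_left_of_disjoint_sup_right hdisjH
  exact sub_eq_zero.mp <|
    eq_zero_of_mem_csub hlead hW (sub_mem hx hy) (by rw [map_sub, hxy, sub_self])
end

section
/- Assume in addition that d_q ∘ d_q = 0. Then the following statements are equivalent: (1) for every h ∈ B⊗̂H there exists ε ∈ B⊗̂R with d_q(h) = d_q(ε); (2) d_q(H) ⊆ d_q(B⊗̂R), where H is viewed inside B⊗̂V via the embedding H ⊆ V ≅ 1 ⊗ V; (3) D = 0 and F = 0; (4) D = 0. Moreover, in statement (1) the element ε necessarily lies in 𝔪(B⊗̂R). -/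
/-!
`B` is a "deformation base": a commutative Noetherian local ℂ-algebra, complete in the
`𝔪`-adic topology, with residue field `ℂ`.  For a ℂ-vector space `X`, the completed
tensor product `B ⊗̂ X` is the `𝔪`-adic completion of `B ⊗[ℂ] X`, realized as the
inverse limit of the modules `(B ⊗[ℂ] X) ⧸ 𝔪^k (B ⊗[ℂ] X) ≅ B/𝔪^k ⊗[ℂ] X`.
-/

open scoped TensorProduct
open IsLocalRing

section CompletedTensor

variable {B : Type} [CommRing B] [Algebra ℂ B] [IsLocalRing B]
  {V : Type} [AddCommGroup V] [Module ℂ V]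

/-- The `B`-linear endomorphism of `B ⊗̂ V` induced by an endomorphism of `V`. -/
noncomputable def hatMap (B : Type) [CommRing B] [Algebra ℂ B] [IsLocalRing B]
    (p : V →ₗ[ℂ] V) : CTP B V →ₗ[B] CTP B V :=
  (AdicCompletion.map (maximalIdeal B) (p.baseChange B)).restrictScalars B

theorem hatMap_iota (p : V →ₗ[ℂ] V) (v : V) :
    hatMap B p (iota B V v) = iota B V (p v) := by
  rw [hatMap, LinearMap.restrictScalars_apply, iota, AdicCompletion.map_of,
    LinearMap.baseChange_tmul, iota]

theorem iota_zero : iota B V 0 = 0 := by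
  rw [iota, TensorProduct.tmul_zero, map_zero]

theorem hatMap_comp_apply (p q : V →ₗ[ℂ] V) (x : CTP B V) :
    hatMap B (p ∘ₗ q) x = hatMap B p (hatMap B q x) := by
  simp [hatMap, AdicCompletion.map_comp_apply, LinearMap.baseChange_comp]

theorem hatMap_zero_apply (x : CTP B V) : hatMap B (0 : V →ₗ[ℂ] V) x = 0 := by
  simp [hatMap]

theorem eq_zero_of_forall_mem_mpow {x : CTP B V} (h : ∀ k, x ∈ mpow B V k) : x = 0 :=
  AdicCompletion.ext fun k => h k

theorem exists_of_mem_csub {W : Submodule ℂ V} {x : CTP B V} (hx : x ∈ csub B V W) (k : ℕ) :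
    ∃ y : B ⊗[ℂ] W,
      x - AdicCompletion.of (maximalIdeal B) (B ⊗[ℂ] V) (W.subtype.baseChange B y) ∈
        mpow B V k := by
  simp only [csub, Submodule.mem_iInf, Submodule.mem_comap] at hx
  obtain ⟨y, hy⟩ := hx k
  refine ⟨y, ?_⟩
  rw [mpow, LinearMap.mem_ker, map_sub, AdicCompletion.eval_of, ← hy]
  simp

theorem of_tmul (b : B) (v : V) :
    AdicCompletion.of (maximalIdeal B) (B ⊗[ℂ] V) (b ⊗ₜ v) = b • iota B V v := by
  rw [iota, ← map_smul, TensorProduct.smul_tmul', smul_eq_mul, mul_one]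

theorem iota_mem_csub {W : Submodule ℂ V} {v : V} (hv : v ∈ W) : iota B V v ∈ csub B V W := by
  simp only [csub, Submodule.mem_iInf, Submodule.mem_comap]
  intro n
  exact ⟨1 ⊗ₜ ⟨v, hv⟩, by simp [iota]⟩

theorem map_of_baseChange_mem {W : Submodule ℂ V} {T : CTP B V →ₗ[B] CTP B V}
    {N : Submodule B (CTP B V)} (hT : ∀ v ∈ W, T (iota B V v) ∈ N) (y : B ⊗[ℂ] W) :
    T (AdicCompletion.of (maximalIdeal B) (B ⊗[ℂ] V) (W.subtype.baseChange B y)) ∈ N := by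
  induction y with
  | zero => simp
  | tmul b w =>
    rw [LinearMap.baseChange_tmul, of_tmul, map_smul]
    exact N.smul_mem b (hT _ w.2)
  | add y z hy hz =>
    rw [map_add, map_add, map_add]
    exact N.add_mem hy hz

theorem csub_top : csub B V ⊤ = ⊤ := by
  rw [eq_top_iff]
  intro x _
  simp only [csub, Submodule.mem_iInf, Submodule.mem_comap]
  intro n
  obtain ⟨z, hz⟩ := Submodule.mkQ_surjective _ (AdicCompletion.eval (maximalIdeal B) _ n x)
  refine ⟨(Submodule.topEquiv (R := ℂ) (M := V)).symm.toLinearMap.baseChange B z, ?_⟩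
  rw [LinearMap.comp_apply, ← LinearMap.comp_apply (LinearMap.baseChange B _),
    ← LinearMap.baseChange_comp, ← hz]
  congr 1
  exact LinearMap.congr_fun LinearMap.baseChange_id z

variable [IsNoetherianRing B]

theorem mpow_eq_pow_smul_top (k : ℕ) :
    mpow B V k = (maximalIdeal B) ^ k • (⊤ : Submodule B (CTP B V)) :=
  (AdicCompletion.pow_smul_top_eq_ker_eval (IsNoetherian.noetherian _)).symm

/-- A `B`-linear map raising the adic filtration by `j` at level `0` does so at every level. -/
theorem map_mem_mpow_add {T : CTP B V →ₗ[B] CTP B V} {j : ℕ} (hT : ∀ x, T x ∈ mpow B V j)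
    {k : ℕ} {x : CTP B V} (hx : x ∈ mpow B V k) : T x ∈ mpow B V (k + j) := by
  rw [mpow_eq_pow_smul_top] at hx ⊢
  rw [pow_add, Submodule.mul_smul, ← mpow_eq_pow_smul_top]
  have h : T x ∈ Submodule.map T ((maximalIdeal B) ^ k • (⊤ : Submodule B (CTP B V))) :=
    Submodule.mem_map_of_mem hx
  rw [Submodule.map_smul''] at h
  refine Submodule.smul_mono le_rfl ?_ h
  rintro _ ⟨y, -, rfl⟩
  exact hT y

theorem map_mem_mpow_s13 (T : CTP B V →ₗ[B] CTP B V) {k : ℕ} {x : CTP B V}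
    (hx : x ∈ mpow B V k) : T x ∈ mpow B V k :=
  map_mem_mpow_add (j := 0) (fun y => by simp [mpow_eq_pow_smul_top]) hx

/-- Membership of `T x` in `𝔪^k (B ⊗̂ V)`, for all `x` in `B ⊗̂ W`, may be tested on `W`. -/
theorem map_mem_mpow_of_forall_iota {W : Submodule ℂ V} {T : CTP B V →ₗ[B] CTP B V} {k : ℕ}
    (hT : ∀ v ∈ W, T (iota B V v) ∈ mpow B V k) {x : CTP B V} (hx : x ∈ csub B V W) :
    T x ∈ mpow B V k := by
  obtain ⟨y, hy⟩ := exists_of_mem_csub hx k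
  have h := add_mem (map_mem_mpow_s13 T hy) (map_of_baseChange_mem hT y)
  rwa [← map_add, sub_add_cancel] at h

/-- A `B`-linear map vanishing on `W` vanishes on `B ⊗̂ W`. -/
theorem map_eq_zero_of_forall_iota {W : Submodule ℂ V} {T : CTP B V →ₗ[B] CTP B V}
    (hT : ∀ v ∈ W, T (iota B V v) = 0) {x : CTP B V} (hx : x ∈ csub B V W) : T x = 0 :=
  eq_zero_of_forall_mem_mpow fun _ =>
    map_mem_mpow_of_forall_iota (fun v hv => hT v hv ▸ zero_mem _) hx

theorem hatMap_apply_of_eqOn_id {W : Submodule ℂ V} {p : V →ₗ[ℂ] V} (hp : ∀ v ∈ W, p v = v)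
    {x : CTP B V} (hx : x ∈ csub B V W) : hatMap B p x = x := by
  have h : (hatMap B p - LinearMap.id : CTP B V →ₗ[B] CTP B V) x = 0 :=
    map_eq_zero_of_forall_iota (fun v hv => by simp [hatMap_iota, hp v hv]) hx
  simpa [sub_eq_zero] using h

theorem hatMap_apply_of_eqOn_zero {W : Submodule ℂ V} {p : V →ₗ[ℂ] V} (hp : ∀ v ∈ W, p v = 0)
    {x : CTP B V} (hx : x ∈ csub B V W) : hatMap B p x = 0 :=
  map_eq_zero_of_forall_iota (fun v hv => by rw [hatMap_iota, hp v hv, iota_zero]) hx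

/-- A `B`-linear map agrees with its leading term `d` up to one step of the filtration. -/
theorem sub_hatMap_mem_mpow_succ {T : CTP B V →ₗ[B] CTP B V} {d : V →ₗ[ℂ] V}
    (hlead : ∀ v : V, T (iota B V v) - iota B V (d v) ∈ mpow B V 1)
    {k : ℕ} {x : CTP B V} (hx : x ∈ mpow B V k) :
    T x - hatMap B d x ∈ mpow B V (k + 1) := by
  refine map_mem_mpow_add (T := T - hatMap B d) (fun y => ?_) hx
  refine map_mem_mpow_of_forall_iota (W := (⊤ : Submodule ℂ V)) (fun v _ => ?_) (by simp [csub_top])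
  simpa [hatMap_iota] using hlead v

end CompletedTensor

/-- Disjoint subspaces are separated by a linear endomorphism. -/
theorem exists_eqOn_id_eqOn_zero {K V : Type*} [Field K] [AddCommGroup V] [Module K V]
    {P Q : Submodule K V} (h : Disjoint P Q) :
    ∃ p : V →ₗ[K] V, (∀ v ∈ P, p v = v) ∧ ∀ v ∈ Q, p v = 0 := by
  obtain ⟨g, hg⟩ := (Q.mkQ ∘ₗ P.subtype).exists_leftInverse_of_injective (by
    rw [LinearMap.ker_comp, Submodule.ker_mkQ, ← Submodule.disjoint_iff_comap_eq_bot]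
    exact h)
  refine ⟨P.subtype ∘ₗ g ∘ₗ Q.mkQ, fun v hv => ?_, fun v hv => ?_⟩
  · exact congrArg Subtype.val (LinearMap.congr_fun hg ⟨v, hv⟩)
  · have : Q.mkQ v = 0 := by simpa using hv
    simp [this]

/-- A linear map injective on a subspace is inverted on it by a linear map. -/
theorem exists_leftInverse_on {K V : Type*} [Field K] [AddCommGroup V] [Module K V]
    {R : Submodule K V} {d : V →ₗ[K] V} (h : Disjoint R (LinearMap.ker d)) :
    ∃ s : V →ₗ[K] V, ∀ v ∈ R, (s ∘ₗ d) v = v := by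
  obtain ⟨g, hg⟩ := (d ∘ₗ R.subtype).exists_leftInverse_of_injective (by
    rw [LinearMap.ker_comp, ← Submodule.disjoint_iff_comap_eq_bot]
    exact h)
  exact ⟨R.subtype ∘ₗ g, fun v hv => congrArg Subtype.val (LinearMap.congr_fun hg ⟨v, hv⟩)⟩

/-- The sum `(B ⊗̂ H) + d_q (B ⊗̂ R) + (B ⊗̂ R)` is direct and `d_q` is injective on `B ⊗̂ R`. -/
theorem eq_zero_of_add_map_add_eq_zero
    {B : Type} [CommRing B] [Algebra ℂ B] [IsLocalRing B] [IsNoetherianRing B]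
    {V : Type} [AddCommGroup V] [Module ℂ V] {H R : Submodule ℂ V} {d : V →ₗ[ℂ] V}
    (hdisjH : Disjoint H (LinearMap.range d ⊔ R)) (hdisjR : Disjoint R (LinearMap.range d))
    (hdisjker : Disjoint R (LinearMap.ker d))
    {dq : CTP B V →ₗ[B] CTP B V}
    (hlead : ∀ v : V, dq (iota B V v) - iota B V (d v) ∈ mpow B V 1)
    {a r f : CTP B V} (ha : a ∈ csub B V H) (hr : r ∈ csub B V R) (hf : f ∈ csub B V R)
    (h : a + dq r + f = 0) : a = 0 ∧ r = 0 ∧ f = 0 := by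
  obtain ⟨p, hpH, hp⟩ := exists_eqOn_id_eqOn_zero hdisjH
  obtain ⟨q, hqR, hq⟩ := exists_eqOn_id_eqOn_zero hdisjR
  obtain ⟨s, hs⟩ := exists_leftInverse_on hdisjker
  have hpd : p ∘ₗ d = 0 :=
    LinearMap.ext fun v => hp _ (Submodule.mem_sup_left (LinearMap.mem_range_self d v))
  have hqd : q ∘ₗ d = 0 := LinearMap.ext fun v => hq _ (LinearMap.mem_range_self d v)
  have key : ∀ k, a ∈ mpow B V k ∧ r ∈ mpow B V k ∧ f ∈ mpow B V k := by
    intro k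
    induction k with
    | zero => simp [mpow_eq_pow_smul_top]
    | succ k ih =>
      have h₁ : a + hatMap B d r + f ∈ mpow B V (k + 1) := by
        have h₂ := neg_mem (sub_hatMap_mem_mpow_succ hlead ih.2.1)
        have h₃ : a + hatMap B d r + f = a + dq r + f + -(dq r - hatMap B d r) := by abel
        rwa [h₃, h, zero_add]
      have ha' : a ∈ mpow B V (k + 1) := by
        have h₂ := map_mem_mpow_s13 (hatMap B p) h₁
        rwa [map_add, map_add, hatMap_apply_of_eqOn_id hpH ha, ← hatMap_comp_apply, hpd,
          hatMap_zero_apply, hatMap_apply_of_eqOn_zero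
            (fun v hv => hp v (Submodule.mem_sup_right hv)) hf, add_zero, add_zero] at h₂
      have h₄ : hatMap B d r + f ∈ mpow B V (k + 1) := by
        rwa [add_assoc, add_mem_cancel_left ha'] at h₁
      have hf' : f ∈ mpow B V (k + 1) := by
        have h₂ := map_mem_mpow_s13 (hatMap B q) h₄
        rwa [map_add, ← hatMap_comp_apply, hqd, hatMap_zero_apply, zero_add,
          hatMap_apply_of_eqOn_id hqR hf] at h₂
      have h₅ := map_mem_mpow_s13 (hatMap B s) ((add_mem_cancel_right hf').1 h₄)
      rw [← hatMap_comp_apply, hatMap_apply_of_eqOn_id hs hr] at h₅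
      exact ⟨ha', h₅, hf'⟩
  exact ⟨eq_zero_of_forall_mem_mpow fun k => (key k).1,
    eq_zero_of_forall_mem_mpow fun k => (key k).2.1,
    eq_zero_of_forall_mem_mpow fun k => (key k).2.2⟩

/-- Assume `d_q ∘ d_q = 0`.  Then the following are equivalent:
(1) for every `h ∈ B ⊗̂ H` there is `ε ∈ B ⊗̂ R` with `d_q h = d_q ε`;
(2) `d_q(H) ⊆ d_q(B ⊗̂ R)`, with `H` viewed inside `B ⊗̂ V` via `1 ⊗ -`;
(3) `D = 0` and `F = 0`;
(4) `D = 0`.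
Moreover, in (1) the element `ε` necessarily lies in `𝔪 (B ⊗̂ R)`. -/
theorem D_eq_zero_tfae
    (B : Type) [CommRing B] [Algebra ℂ B] [IsNoetherianRing B] [IsLocalRing B]
    [IsAdicComplete (maximalIdeal B) B]
    (hres : Function.Bijective (algebraMap ℂ (ResidueField B)))
    (V : Type) [AddCommGroup V] [Module ℂ V]
    (H I R : Submodule ℂ V) (d : V →ₗ[ℂ] V)
    (hsup : H ⊔ I ⊔ R = ⊤)
    (hdisjH : Disjoint H (I ⊔ R)) (hdisjIR : Disjoint I R)
    (hI : I = LinearMap.range d)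
    (hker : LinearMap.ker d = H ⊔ I)
    (dq : CTP B V →ₗ[B] CTP B V)
    (hlead : ∀ v : V, dq (iota B V v) - iota B V (d v) ∈ mpow B V 1)
    (D E F : CTP B V →ₗ[B] CTP B V)
    (hD : ∀ h ∈ csub B V H, D h ∈ csub B V H)
    (hE : ∀ h ∈ csub B V H, E h ∈ csub B V R)
    (hF : ∀ h ∈ csub B V H, F h ∈ csub B V R)
    (hDEF : ∀ h ∈ csub B V H, dq h = D h + dq (E h) + F h)
    (hdq2 : ∀ x : CTP B V, dq (dq x) = 0) :
    ([(∀ h ∈ csub B V H, ∃ ε ∈ csub B V R, dq h = dq ε),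
      (∀ v ∈ H, dq (iota B V v) ∈ Submodule.map dq (csub B V R)),
      ((∀ h ∈ csub B V H, D h = 0) ∧ (∀ h ∈ csub B V H, F h = 0)),
      (∀ h ∈ csub B V H, D h = 0)].TFAE) ∧
    (∀ h ∈ csub B V H, ∀ ε ∈ csub B V R, dq h = dq ε → ε ∈ mpow B V 1) := by
  have hdisjker : Disjoint R (LinearMap.ker d) := by
    rw [hker]
    exact (Disjoint.disjoint_sup_left_of_disjoint_sup_right hdisjIR hdisjH).symm
  subst hI
  have direct {a r f : CTP B V} (ha : a ∈ csub B V H) (hr : r ∈ csub B V R)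
      (hf : f ∈ csub B V R) (h : a + dq r + f = 0) : a = 0 ∧ r = 0 ∧ f = 0 :=
    eq_zero_of_add_map_add_eq_zero hdisjH hdisjIR.symm hdisjker hlead ha hr hf h
  refine ⟨?_, fun h hh ε hε heq => ?_⟩
  · tfae_have 1 → 2 := fun h v hv => by
      obtain ⟨ε, hε, heq⟩ := h _ (iota_mem_csub hv)
      exact ⟨ε, hε, heq.symm⟩
    tfae_have 2 → 3 := fun h => by
      have hv : ∀ v ∈ H, D (iota B V v) = 0 ∧ F (iota B V v) = 0 := fun v hv => by
        obtain ⟨ε, hε, heq⟩ := h v hv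
        have hv' : iota B V v ∈ csub B V H := iota_mem_csub hv
        obtain ⟨h₁, -, h₂⟩ := direct (hD _ hv') (sub_mem (hE _ hv') hε) (hF _ hv') (by
          rw [map_sub, heq, hDEF _ hv']
          abel)
        exact ⟨h₁, h₂⟩
      exact ⟨fun x hx => map_eq_zero_of_forall_iota (fun v hvH => (hv v hvH).1) hx,
        fun x hx => map_eq_zero_of_forall_iota (fun v hvH => (hv v hvH).2) hx⟩
    tfae_have 3 → 4 := fun h => h.1
    tfae_have 4 → 1 := fun h x hx => by
      have heq := hDEF x hx
      rw [h x hx, zero_add] at heq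
      have hdF : dq (F x) = 0 := by
        have h₂ := congrArg dq heq
        rwa [map_add, hdq2, hdq2, zero_add, eq_comm] at h₂
      have hF0 := (direct (zero_mem _) (hF x hx) (zero_mem _) (by simpa using hdF)).2.1
      exact ⟨E x, hE x hx, by rw [heq, hF0, add_zero]⟩
    tfae_finish
  · obtain ⟨s, hs⟩ := exists_leftInverse_on hdisjker
    have hdh : hatMap B d h = 0 := hatMap_apply_of_eqOn_zero
      (fun v hv => LinearMap.mem_ker.1 (hker ▸ Submodule.mem_sup_left hv)) hh
    have h₁ := sub_hatMap_mem_mpow_succ hlead (k := 0) (x := h - ε)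
      (by simp [mpow_eq_pow_smul_top])
    rw [map_sub, map_sub, hdh, heq, sub_self, zero_sub, zero_sub, neg_neg] at h₁
    have h₂ := map_mem_mpow_s13 (hatMap B s) h₁
    rwa [← hatMap_comp_apply, hatMap_apply_of_eqOn_id hs hε] at h₂
end
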